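/- Let G be a finite group, a a commuting n-tuple in G, R ≤ C_G(a), and k_i the smallest positive integer with a_i^{k_i} ∈ R. Then the map (ℤ/ℓ)ⁿ × R → (ℤ/ℓ)ⁿ × C_G(a) given by (t, z) ↦ (t, (∏ a_i^{k_i t_i − t_i})·z) lands in ev_a⁻¹(R) and is a two-sided inverse to the winding isomorphism ω(t,z) = (t, (∏ a_i^{t_i − k_i t_i})·z). -/

import Mathlib

theorem List.prod_ofFn_mul_distrib {M : Type*} [Monoid M] {n : ℕ} (f g : Fin n → M)
    (h : ∀ i j, Commute (f i) (g j)) :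
    (List.ofFn f).prod * (List.ofFn g).prod = (List.ofFn fun i => f i * g i).prod := by
  induction n with
  | zero => simp
  | succ n ih =>
    have hc : Commute (List.ofFn fun i : Fin n => f i.succ).prod (g 0) := by
      refine Commute.list_prod_left _ _ fun x hx => ?_
      obtain ⟨i, rfl⟩ := (List.mem_ofFn' _ _).1 hx
      exact h _ _
    simp only [List.ofFn_succ, List.prod_cons]
    rw [← ih (fun i => f i.succ) (fun i => g i.succ) fun i j => h _ _]
    simp only [mul_assoc]
    rw [← mul_assoc _ (g 0), hc.eq, mul_assoc]

theorem pow_zmodVal_add {M : Type*} [Monoid M] {ℓ : ℕ} [NeZero ℓ] {a : M} (ha : a ^ ℓ = 1)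
    (x y : ZMod ℓ) : a ^ x.val * a ^ y.val = a ^ (x + y).val := by
  rw [ZMod.val_add, ← pow_add, pow_eq_pow_mod _ ha]

theorem pow_zmodVal_natCast_mul {M : Type*} [Monoid M] {ℓ : ℕ} {a : M} (ha : a ^ ℓ = 1)
    (k : ℕ) (x : ZMod ℓ) : a ^ ((k : ZMod ℓ) * x).val = (a ^ k) ^ x.val := by
  rw [ZMod.val_mul, ZMod.val_natCast, ← pow_eq_pow_mod _ ha, pow_mul, ← pow_eq_pow_mod _ ha]

theorem List.prod_ofFn_pow_zmodVal_mul {M : Type*} [Monoid M] {n ℓ : ℕ} [NeZero ℓ]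
    {a : Fin n → M} (hcomm : ∀ i j, Commute (a i) (a j)) (ha : ∀ i, a i ^ ℓ = 1)
    (x y : Fin n → ZMod ℓ) :
    (List.ofFn fun i => a i ^ (x i).val).prod * (List.ofFn fun i => a i ^ (y i).val).prod =
      (List.ofFn fun i => a i ^ (x i + y i).val).prod := by
  rw [List.prod_ofFn_mul_distrib _ _ fun i j => (hcomm i j).pow_pow _ _]
  simp only [pow_zmodVal_add (ha _)]


/-- The map `(t, z) ↦ (t, (∏ aᵢ^{kᵢtᵢ − tᵢ})·z)` lands in `ev_a⁻¹(R)` and is a two-sided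
inverse to the winding isomorphism `ω(t,z) = (t, (∏ aᵢ^{tᵢ − kᵢtᵢ})·z)`. -/
theorem winding_inverse {G : Type*} [Group G] [Fintype G] {n ℓ : ℕ}
    (hpos : 0 < ℓ) (hdvd : Fintype.card G ∣ ℓ)
    (a : Fin n → G) (hcomm : ∀ i j, Commute (a i) (a j))
    (R : Subgroup G) (hR : R ≤ Subgroup.centralizer (Set.range a))
    (k : Fin n → ℕ) (hk : ∀ i, IsLeast {m : ℕ | 0 < m ∧ a i ^ m ∈ R} (k i)) :
    (∀ (t : Fin n → ZMod ℓ) (z : G), z ∈ R →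
      ((List.ofFn fun i => a i ^ ((k i : ZMod ℓ) * t i - t i).val).prod * z
          ∈ Subgroup.centralizer (Set.range a) ∧
        (List.ofFn fun i => a i ^ (t i).val).prod *
          ((List.ofFn fun i => a i ^ ((k i : ZMod ℓ) * t i - t i).val).prod * z) ∈ R)) ∧
    (∀ (t : Fin n → ZMod ℓ) (z : G), z ∈ Subgroup.centralizer (Set.range a) →
      (List.ofFn fun i => a i ^ (t i).val).prod * z ∈ R →
      (List.ofFn fun i => a i ^ ((k i : ZMod ℓ) * t i - t i).val).prod *
        ((List.ofFn fun i => a i ^ (t i - (k i : ZMod ℓ) * t i).val).prod * z) = z) ∧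
    (∀ (t : Fin n → ZMod ℓ) (z : G), z ∈ R →
      (List.ofFn fun i => a i ^ (t i - (k i : ZMod ℓ) * t i).val).prod *
        ((List.ofFn fun i => a i ^ ((k i : ZMod ℓ) * t i - t i).val).prod * z) = z) := by
  have : NeZero ℓ := ⟨hpos.ne'⟩
  have ha : ∀ i, a i ^ ℓ = 1 := fun i => by
    obtain ⟨c, rfl⟩ := hdvd
    rw [pow_mul, pow_card_eq_one, one_pow]
  have hmem : ∀ i, a i ∈ Subgroup.centralizer (Set.range a) := fun i => by
    rw [Subgroup.mem_centralizer_iff]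
    rintro _ ⟨j, rfl⟩
    exact hcomm j i
  refine ⟨fun t z hz => ⟨mul_mem (list_prod_mem fun x hx => ?_) (hR hz), ?_⟩,
    fun t z _ _ => ?_, fun t z _ => ?_⟩
  · obtain ⟨i, rfl⟩ := (List.mem_ofFn' _ _).1 hx
    exact pow_mem (hmem i) _
  · rw [← mul_assoc, List.prod_ofFn_pow_zmodVal_mul hcomm ha]
    refine mul_mem (list_prod_mem fun x hx => ?_) hz
    obtain ⟨i, rfl⟩ := (List.mem_ofFn' _ _).1 hx
    simp only [add_sub_cancel, pow_zmodVal_natCast_mul (ha i)]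
    exact pow_mem (hk i).1.2 _
  all_goals
    rw [← mul_assoc, List.prod_ofFn_pow_zmodVal_mul hcomm ha]
    simp
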